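/- Log-difference bound off the estimated support. Let β̂ ∈ ℝᵖ be arbitrary, w = β̂ − β, and assume S ≠ ∅. Then for every τ ∈ (0,1), Σ_{j∉Ŝ} [ log(1 + τ⁻¹|β_j|) − log(1 + τ⁻¹|β̂_j|) ] ≤ [1 + c₃⁻¹ log(τ⁻¹)] · s^{1/2} ‖w‖₂, where c₃ = min_{j∈S}|β_j| and s = |S|. (For j ∉ Ŝ one has β̂_j = 0, so the summand is log(1+τ⁻¹|β_j|).) -/

import Mathlib

/-- For `0 < c ≤ x` and `0 < τ < 1`, the map `x ↦ log (1 + τ⁻¹ x)` is dominated by a linear one. -/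
theorem log_one_add_inv_mul_le {τ c x : ℝ} (hτ : τ ∈ Set.Ioo (0 : ℝ) 1) (hc : 0 < c)
    (hcx : c ≤ x) : Real.log (1 + τ⁻¹ * x) ≤ (1 + c⁻¹ * Real.log τ⁻¹) * x := by
  obtain ⟨hτ0, hτ1⟩ := hτ
  have hx : 0 < x := hc.trans_le hcx
  have hL : 0 ≤ Real.log τ⁻¹ := Real.log_nonneg (one_le_inv_iff₀.2 ⟨hτ0, hτ1.le⟩)
  have hfac : 1 + τ⁻¹ * x = (τ + x) * τ⁻¹ := by field_simp
  have hlog : Real.log (τ + x) ≤ x := by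
    linarith [Real.log_le_sub_one_of_pos (add_pos hτ0 hx)]
  have hratio : 1 ≤ c⁻¹ * x := by
    rw [inv_mul_eq_div]
    exact (one_le_div hc).2 hcx
  rw [hfac, Real.log_mul (by positivity) (by positivity)]
  nlinarith [mul_le_mul_of_nonneg_right hratio hL]

/-- The `ℓ¹` norm over a finite set `s` is at most `√|s|` times the full `ℓ²` norm. -/
theorem sum_abs_le_sqrt_card_mul_sqrt {ι : Type*} [Fintype ι] (s : Finset ι) (w : ι → ℝ) :
    ∑ j ∈ s, |w j| ≤ Real.sqrt s.card * Real.sqrt (∑ j, w j ^ 2) := by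
  rw [← Real.sqrt_mul (Nat.cast_nonneg _)]
  refine Real.le_sqrt_of_sq_le (sq_sum_le_card_mul_sum_sq.trans ?_)
  simp only [sq_abs]
  gcongr
  exact Finset.subset_univ s

/-- **Log-difference bound off the estimated support.**
For `β, β̂ ∈ ℝᵖ`, `w = β̂ − β`, `S = {j : β_j ≠ 0} ≠ ∅`, `Ŝ = {j : β̂_j ≠ 0}`,
`c₃ = min_{j∈S} |β_j|` and `s = |S|`, for every `τ ∈ (0,1)`:
`Σ_{j∉Ŝ} [log(1 + τ⁻¹|β_j|) − log(1 + τ⁻¹|β̂_j|)] ≤ [1 + c₃⁻¹ log(τ⁻¹)] s^{1/2} ‖w‖₂`. -/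
theorem logDiff_bound_off_estimated_support {p : ℕ} (τ : ℝ) (hτ : τ ∈ Set.Ioo (0 : ℝ) 1)
    (β βhat : Fin p → ℝ)
    (hS : (Finset.univ.filter fun j => β j ≠ 0).Nonempty) :
    ∑ j ∈ Finset.univ.filter (fun j => ¬ βhat j ≠ 0),
        (Real.log (1 + τ⁻¹ * |β j|) - Real.log (1 + τ⁻¹ * |βhat j|))
      ≤ (1 + ((Finset.univ.filter fun j => β j ≠ 0).inf' hS fun j => |β j|)⁻¹ *
            Real.log τ⁻¹) *
          Real.sqrt ((Finset.univ.filter fun j => β j ≠ 0).card) *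
          Real.sqrt (∑ j, (βhat j - β j) ^ 2) := by
  set S := Finset.univ.filter fun j => β j ≠ 0 with hSdef
  set c := S.inf' hS fun j => |β j| with hcdef
  have hc : 0 < c := by
    rw [hcdef, Finset.lt_inf'_iff]
    exact fun j hj => abs_pos.2 (Finset.mem_filter.1 hj).2
  have hK : 0 ≤ 1 + c⁻¹ * Real.log τ⁻¹ := by
    have := Real.log_nonneg (one_le_inv_iff₀.2 ⟨hτ.1, hτ.2.le⟩)
    positivity
  have hsum : ∑ j ∈ Finset.univ.filter (fun j => ¬ βhat j ≠ 0),
      (Real.log (1 + τ⁻¹ * |β j|) - Real.log (1 + τ⁻¹ * |βhat j|))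
        ≤ ∑ j ∈ S, (1 + c⁻¹ * Real.log τ⁻¹) * |βhat j - β j| := by
    rw [Finset.sum_filter, hSdef, Finset.sum_filter]
    refine Finset.sum_le_sum fun j _ => ?_
    by_cases hhat : βhat j = 0
    · by_cases hβ : β j = 0
      · simp [hhat, hβ]
      · have hcj : c ≤ |β j| := Finset.inf'_le _ (Finset.mem_filter.2 ⟨Finset.mem_univ j, hβ⟩)
        simpa [hhat, hβ] using log_one_add_inv_mul_le hτ hc hcj
    · rw [if_neg (not_not.2 hhat)]
      split_ifs <;> positivity
  rw [← Finset.mul_sum] at hsum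
  rw [mul_assoc]
  exact hsum.trans
    (mul_le_mul_of_nonneg_left (sum_abs_le_sqrt_card_mul_sqrt S fun j => βhat j - β j) hK)
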